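/- In the copula-update process, for every fixed y ∈ ℝ the sequence (P_M(y))_{M ≥ 0} is a martingale with respect to the filtration (𝓕_M)_{M ≥ 0}: each P_M(y) is 𝓕_M-measurable, integrable, and E[P_M(y) | 𝓕_{M−1}] = P_{M−1}(y) almost surely for every M ≥ 1. -/

import Mathlib

open MeasureTheory ProbabilityTheory Filter Topology

/-- The standard normal cumulative distribution function `Φ`. -/
noncomputable def Phi (t : ℝ) : ℝ := ((gaussianReal 0 1) (Set.Iic t)).toReal

/-- The inverse (quantile function) of the standard normal CDF. -/
noncomputable def PhiInv (u : ℝ) : ℝ := sInf {x : ℝ | u ≤ Phi x}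

/-- The Gaussian copula update function `H_ρ(u,v)`, extended by `H_ρ(0,v) = 0` and
`H_ρ(1,v) = 1`. -/
noncomputable def Hcop (ρ u v : ℝ) : ℝ :=
  if u = 0 then 0
  else if u = 1 then 1
  else Phi ((PhiInv u - ρ * PhiInv v) / Real.sqrt (1 - ρ ^ 2))

/-- The copula-update process of the martingale posterior construction: an initial random
CDF `P₀`, samples `y_{n+k}` whose conditional probability integral transform
`P_{k−1}(y_{n+k})` is uniform on `[0,1]` given `𝓕_{k−1}`, and the recursive Gaussian
copula update `P_k(y) = (1 − α_{n+k})·P_{k−1}(y) + α_{n+k}·H_ρ(P_{k−1}(y), P_{k−1}(y_{n+k}))`.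
Here `Pk k ω` is the random function `P_k` and `y k` is the random variable `y_{n+k}`. -/
structure CopulaProcess (Ω : Type*) [mΩ : MeasurableSpace Ω] (P : Measure Ω) where
  /-- the copula parameter `ρ ∈ (−1,1)` -/
  ρ : ℝ
  hρ : ρ ∈ Set.Ioo (-1 : ℝ) 1
  /-- the number `n` of originally observed data points -/
  n : ℕ
  hn : 1 ≤ n
  /-- the learning rates: `α (n+k)` is the rate `α_{n+k}` used in step `k` -/
  α : ℕ → ℝ
  hα : ∀ k, 1 ≤ k → α (n + k) ∈ Set.Ioo (0 : ℝ) 1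
  /-- the filtration `(𝓕_k)_{k ≥ 0}` -/
  ℱ : Filtration ℕ mΩ
  /-- `Pk k ω` is the random distribution function `P_k` -/
  Pk : ℕ → Ω → ℝ → ℝ
  /-- `y k` is the random variable `y_{n+k}` (for `k ≥ 1`) -/
  y : ℕ → Ω → ℝ
  /-- `P₀(t)` is `𝓕₀`-measurable for every `t` -/
  meas0 : ∀ t : ℝ, StronglyMeasurable[ℱ 0] fun ω => Pk 0 ω t
  /-- `P₀` is continuous -/
  cont0 : ∀ ω, Continuous (Pk 0 ω)
  /-- `P₀` is strictly increasing -/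
  strictMono0 : ∀ ω, StrictMono (Pk 0 ω)
  /-- `P₀` takes values in `(0,1)` (it is strictly increasing onto `(0,1)`) -/
  mem0 : ∀ ω t, Pk 0 ω t ∈ Set.Ioo (0 : ℝ) 1
  /-- `P₀` has limit `0` at `−∞` -/
  tendsto_atBot0 : ∀ ω, Tendsto (Pk 0 ω) atBot (𝓝 0)
  /-- `P₀` has limit `1` at `+∞` -/
  tendsto_atTop0 : ∀ ω, Tendsto (Pk 0 ω) atTop (𝓝 1)
  /-- `y_{n+k}` is `𝓕_k`-measurable -/
  measy : ∀ k, 1 ≤ k → StronglyMeasurable[ℱ k] (y k)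
  /-- conditionally on `𝓕_{k−1}`, the random variable `P_{k−1}(y_{n+k})` is uniformly
  distributed on `[0,1]` -/
  unif : ∀ k, 1 ≤ k → ∀ A : Set Ω, MeasurableSet[ℱ (k - 1)] A →
    ∀ u ∈ Set.Icc (0 : ℝ) 1,
      P (A ∩ {ω | Pk (k - 1) ω (y k ω) ≤ u}) = P A * ENNReal.ofReal u
  /-- the recursive Gaussian copula update defining `P_k` from `P_{k−1}` -/
  step : ∀ k, 1 ≤ k → ∀ ω t,
    Pk k ω t = (1 - α (n + k)) * Pk (k - 1) ω t
      + α (n + k) * Hcop ρ (Pk (k - 1) ω t) (Pk (k - 1) ω (y k ω))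

lemma Phi_eq_cdf : Phi = cdf (gaussianReal 0 1) := by
  ext x
  rw [cdf_eq_real]
  rfl

lemma Phi_strictMono : StrictMono Phi := by
  have : (gaussianReal 0 1).IsOpenPosMeasure :=
    (gaussianReal_absolutelyContinuous' 0 one_ne_zero).isOpenPosMeasure
  intro a b hab
  refine (ENNReal.toReal_lt_toReal (measure_ne_top _ _) (measure_ne_top _ _)).2 ?_
  have hpos : 0 < gaussianReal 0 1 (Set.Ioc a b) :=
    (isOpen_Ioo.measure_pos _ (Set.nonempty_Ioo.2 hab)).trans_le
      (measure_mono Set.Ioo_subset_Ioc_self)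
  rw [← Set.Iic_union_Ioc_eq_Iic hab.le,
    measure_union (Set.Iic_disjoint_Ioc le_rfl) measurableSet_Ioc]
  exact ENNReal.lt_add_right (measure_ne_top _ _) hpos.ne'

lemma Phi_mem_Ioo (x : ℝ) : Phi x ∈ Set.Ioo (0 : ℝ) 1 := by
  constructor
  · refine lt_of_le_of_lt ?_ (Phi_strictMono (sub_one_lt x))
    rw [Phi_eq_cdf]
    exact cdf_nonneg _ _
  · refine (Phi_strictMono (lt_add_one x)).trans_le ?_
    rw [Phi_eq_cdf]
    exact cdf_le_one _ _

lemma Phi_continuous : Continuous Phi := by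
  rw [Phi_eq_cdf, continuous_iff_continuousAt]
  intro a
  have : NullSingletonClass (gaussianReal 0 1) := nullSingletonClass_gaussianReal one_ne_zero
  have h0 : (cdf (gaussianReal 0 1)).measure {a} = 0 := by
    rw [measure_cdf]
    exact measure_singleton a
  rw [StieltjesFunction.measure_singleton, ENNReal.ofReal_eq_zero] at h0
  have hl : Function.leftLim (cdf (gaussianReal 0 1)) a = cdf (gaussianReal 0 1) a :=
    le_antisymm ((monotone_cdf _).leftLim_le le_rfl) (by linarith)
  rw [continuousAt_iff_continuous_left'_right']
  exact ⟨((monotone_cdf _).continuousWithinAt_Iio_iff_leftLim_eq).2 hl,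
    ((cdf (gaussianReal 0 1)).right_continuous a).mono Set.Ioi_subset_Ici_self⟩

lemma exists_Phi_eq {u : ℝ} (hu : u ∈ Set.Ioo (0 : ℝ) 1) : ∃ x, Phi x = u := by
  have hbot : Tendsto Phi atBot (𝓝 0) := Phi_eq_cdf ▸ tendsto_cdf_atBot _
  have htop : Tendsto Phi atTop (𝓝 1) := Phi_eq_cdf ▸ tendsto_cdf_atTop _
  exact mem_range_of_exists_le_of_exists_ge Phi_continuous
    ((hbot.eventually_lt_const hu.1).exists.imp fun _ h => h.le)
    ((htop.eventually_const_lt hu.2).exists.imp fun _ h => h.le)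

lemma PhiInv_Phi (x : ℝ) : PhiInv (Phi x) = x := by
  have : {z : ℝ | Phi x ≤ Phi z} = Set.Ici x := by
    ext z
    exact Phi_strictMono.le_iff_le
  rw [PhiInv, this, csInf_Ici]

lemma Phi_PhiInv {u : ℝ} (hu : u ∈ Set.Ioo (0 : ℝ) 1) : Phi (PhiInv u) = u := by
  obtain ⟨x, rfl⟩ := exists_Phi_eq hu
  rw [PhiInv_Phi]

lemma PhiInv_le_iff {u : ℝ} (hu : u ∈ Set.Ioo (0 : ℝ) 1) (x : ℝ) :
    PhiInv u ≤ x ↔ u ≤ Phi x := by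
  obtain ⟨z, rfl⟩ := exists_Phi_eq hu
  rw [PhiInv_Phi, Phi_strictMono.le_iff_le]

lemma PhiInv_continuousOn : ContinuousOn PhiInv (Set.Ioo 0 1) := by
  intro u hu
  refine ContinuousAt.continuousWithinAt ?_
  have hmono : StrictMonoOn PhiInv (Set.Ioo 0 1) := by
    intro a ha b hb hab
    rwa [← Phi_strictMono.lt_iff_lt, Phi_PhiInv ha, Phi_PhiInv hb]
  refine hmono.continuousAt_of_image_mem_nhds (isOpen_Ioo.mem_nhds hu) ?_
  have : PhiInv '' Set.Ioo 0 1 = Set.univ :=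
    Set.eq_univ_of_forall fun x => ⟨Phi x, Phi_mem_Ioo x, PhiInv_Phi x⟩
  rw [this]
  exact univ_mem

lemma Measurable.PhiInv_comp {Ω : Type*} {m : MeasurableSpace Ω} {f : Ω → ℝ}
    (hf : Measurable f) (h : ∀ ω, f ω ∈ Set.Ioo (0 : ℝ) 1) :
    Measurable fun ω => PhiInv (f ω) :=
  PhiInv_continuousOn.domRestrict.measurable.comp (hf.subtype_mk (h := h))

lemma Hcop_eq_of_mem_Ioo (ρ v : ℝ) {u : ℝ} (hu : u ∈ Set.Ioo (0 : ℝ) 1) :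
    Hcop ρ u v = Phi ((PhiInv u - ρ * PhiInv v) / Real.sqrt (1 - ρ ^ 2)) := by
  rw [Hcop, if_neg hu.1.ne', if_neg hu.2.ne]

/-- If `Z` and `W` are independent standard normal variables, then so is `ρ Z + √(1 - ρ²) W`;
this is the resulting identity for `Φ` after conditioning on `Z`. -/
lemma integral_Phi_div_sqrt {ρ : ℝ} (hρ : ρ ∈ Set.Ioo (-1 : ℝ) 1) (a : ℝ) :
    ∫ z, Phi ((a - ρ * z) / Real.sqrt (1 - ρ ^ 2)) ∂(gaussianReal 0 1) = Phi a := by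
  have hpos : 0 < 1 - ρ ^ 2 := by nlinarith [hρ.1, hρ.2]
  set s := Real.sqrt (1 - ρ ^ 2) with hs
  have hs0 : 0 < s := Real.sqrt_pos.2 hpos
  have hsq : s ^ 2 = 1 - ρ ^ 2 := Real.sq_sqrt hpos.le
  have hlaw : ((gaussianReal 0 1).prod (gaussianReal 0 1)).map
      (fun p : ℝ × ℝ => ρ * p.1 + s * p.2) = gaussianReal 0 1 := by
    have h := gaussianReal_conv_gaussianReal (m₁ := ρ * 0) (m₂ := s * 0)
      (v₁ := NNReal.mk (ρ ^ 2) (sq_nonneg _) * 1) (v₂ := NNReal.mk (s ^ 2) (sq_nonneg _) * 1)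
    rw [← gaussianReal_map_const_mul, ← gaussianReal_map_const_mul, Measure.conv,
      Measure.map_prod_map _ _ (by fun_prop) (by fun_prop),
      Measure.map_map (by fun_prop) (by fun_prop)] at h
    refine h.trans ?_
    congr 1
    · ring
    · ext
      simp [hsq]
  have hmeas : MeasurableSet {p : ℝ × ℝ | ρ * p.1 + s * p.2 ≤ a} :=
    measurableSet_le (by fun_prop) (by fun_prop)
  have hsec : ∀ z, Prod.mk z ⁻¹' {p : ℝ × ℝ | ρ * p.1 + s * p.2 ≤ a}
      = Set.Iic ((a - ρ * z) / s) := by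
    intro z
    ext w
    simp only [Set.mem_preimage, Set.mem_ofPred_eq, Set.mem_Iic, le_div_iff₀ hs0]
    constructor <;> intro h <;> linarith
  have hPhi : Phi a = (∫⁻ z, gaussianReal 0 1 (Set.Iic ((a - ρ * z) / s))
      ∂(gaussianReal 0 1)).toReal := by
    have : gaussianReal 0 1 (Set.Iic a) = ((gaussianReal 0 1).prod (gaussianReal 0 1))
        {p : ℝ × ℝ | ρ * p.1 + s * p.2 ≤ a} := by
      conv_lhs => rw [← hlaw]
      rw [Measure.map_apply (by fun_prop) measurableSet_Iic]
      rfl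
    rw [Phi, this, Measure.prod_apply hmeas]
    simp_rw [hsec]
  rw [hPhi]
  refine integral_toReal ?_ (ae_of_all _ fun z => measure_lt_top _ _)
  have := measurable_measure_prodMk_left (ν := gaussianReal 0 1) hmeas
  simp_rw [hsec] at this
  exact this.aemeasurable

/-- If `Z` has law `ν` and is independent of the σ-algebra `m`, then
`E[g(X, Z) ; A] = E[∫ g(X, z) dν(z) ; A]` for `m`-measurable `X` and `A`. -/
lemma setIntegral_comp_prod_of_map_restrict_eq {Ω : Type*} {m mΩ : MeasurableSpace Ω}
    (hm : m ≤ mΩ) {P : Measure Ω} [IsFiniteMeasure P] {ν : Measure ℝ} [IsProbabilityMeasure ν]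
    {X Z : Ω → ℝ} (hX : Measurable[m] X) (hZ : Measurable Z)
    (hind : ∀ A, MeasurableSet[m] A → (P.restrict A).map Z = P A • ν)
    {g : ℝ × ℝ → ℝ} (hg : Measurable g) {C : ℝ} (hgC : ∀ p, ‖g p‖ ≤ C)
    {A : Set Ω} (hA : MeasurableSet[m] A) :
    ∫ ω in A, g (X ω, Z ω) ∂P = ∫ ω in A, ∫ z, g (X ω, z) ∂ν ∂P := by
  have hX' : Measurable X := hX.mono hm le_rfl
  have hprod : (P.restrict A).map (fun ω => (X ω, Z ω)) = ((P.restrict A).map X).prod ν := by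
    refine (Measure.prod_eq fun s t hs ht => ?_).symm
    rw [Measure.map_apply (hX'.prodMk hZ) (hs.prod ht), Measure.map_apply hX' hs,
      Measure.restrict_apply (hX' hs), Set.mk_preimage_prod,
      Measure.restrict_apply ((hX' hs).inter (hZ ht))]
    have h := congrArg (fun μ => μ t) (hind (X ⁻¹' s ∩ A) ((hX hs).inter hA))
    simp only [Measure.map_apply hZ ht, Measure.restrict_apply (hZ ht), Measure.smul_apply,
      smul_eq_mul] at h
    rw [← h]
    congr 1
    ext ω
    simp only [Set.mem_inter_iff]
    tauto
  have hint : Integrable g (((P.restrict A).map X).prod ν) :=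
    Integrable.of_bound hg.aestronglyMeasurable C (ae_of_all _ hgC)
  calc ∫ ω in A, g (X ω, Z ω) ∂P
      = ∫ p, g p ∂((P.restrict A).map (fun ω => (X ω, Z ω))) :=
        (integral_map (hX'.prodMk hZ).aemeasurable hg.aestronglyMeasurable).symm
    _ = ∫ x, ∫ z, g (x, z) ∂ν ∂((P.restrict A).map X) := by
        rw [hprod, integral_prod _ hint]
    _ = ∫ ω in A, ∫ z, g (X ω, z) ∂ν ∂P :=
        integral_map hX'.aemeasurable
          hg.stronglyMeasurable.integral_prod_right'.aestronglyMeasurable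

lemma Measurable.eval_of_continuous {Ω : Type*} {m : MeasurableSpace Ω} {F : Ω → ℝ → ℝ}
    (hc : ∀ ω, Continuous (F ω)) (hF : ∀ t, Measurable fun ω => F ω t) {Y : Ω → ℝ}
    (hY : Measurable Y) : Measurable fun ω => F ω (Y ω) :=
  (measurable_uncurry_of_continuous_of_measurable (u := fun t ω => F ω t) hc hF).comp
    (hY.prodMk measurable_id)

namespace CopulaProcess

variable {Ω : Type*} [mΩ : MeasurableSpace Ω] {P : Measure Ω} (Q : CopulaProcess Ω P)

lemma continuous_and_mem_Ioo (k : ℕ) (ω : Ω) :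
    Continuous (Q.Pk k ω) ∧ ∀ t, Q.Pk k ω t ∈ Set.Ioo (0 : ℝ) 1 := by
  induction k with
  | zero => exact ⟨Q.cont0 ω, Q.mem0 ω⟩
  | succ k ih =>
    obtain ⟨hc, hmem⟩ := ih
    have hstep : Q.Pk (k + 1) ω = fun t => (1 - Q.α (Q.n + (k + 1))) * Q.Pk k ω t
        + Q.α (Q.n + (k + 1)) * Phi ((PhiInv (Q.Pk k ω t)
          - Q.ρ * PhiInv (Q.Pk k ω (Q.y (k + 1) ω))) / Real.sqrt (1 - Q.ρ ^ 2)) := by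
      ext t
      rw [Q.step (k + 1) (by lia), Nat.add_sub_cancel, Hcop_eq_of_mem_Ioo _ _ (hmem t)]
    have hα := Q.hα (k + 1) (by lia)
    rw [hstep]
    constructor
    · have hinv : Continuous fun t => PhiInv (Q.Pk k ω t) :=
        PhiInv_continuousOn.comp_continuous hc hmem
      exact (continuous_const.mul hc).add (continuous_const.mul
        (Phi_continuous.comp ((hinv.sub continuous_const).div_const _)))
    · intro t
      exact convex_Ioo (0 : ℝ) 1 (hmem t) (Phi_mem_Ioo _) (sub_nonneg.2 hα.2.le) hα.1.le
        (by ring)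

lemma mem_Ioo (k : ℕ) (ω : Ω) (t : ℝ) : Q.Pk k ω t ∈ Set.Ioo (0 : ℝ) 1 :=
  (Q.continuous_and_mem_Ioo k ω).2 t

lemma step_eq (k : ℕ) (ω : Ω) (t : ℝ) :
    Q.Pk (k + 1) ω t = (1 - Q.α (Q.n + (k + 1))) * Q.Pk k ω t
      + Q.α (Q.n + (k + 1)) * Phi ((PhiInv (Q.Pk k ω t)
        - Q.ρ * PhiInv (Q.Pk k ω (Q.y (k + 1) ω))) / Real.sqrt (1 - Q.ρ ^ 2)) := by
  rw [Q.step (k + 1) (by lia), Nat.add_sub_cancel, Hcop_eq_of_mem_Ioo _ _ (Q.mem_Ioo k ω t)]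

lemma measurable_Pk (k : ℕ) (t : ℝ) : Measurable[Q.ℱ k] fun ω => Q.Pk k ω t := by
  induction k generalizing t with
  | zero => exact (Q.meas0 t).measurable
  | succ k ih =>
    have ih' : ∀ t, Measurable[Q.ℱ (k + 1)] fun ω => Q.Pk k ω t :=
      fun t => (ih t).mono (Q.ℱ.mono k.le_succ) le_rfl
    have hV := Measurable.eval_of_continuous (fun ω => (Q.continuous_and_mem_Ioo k ω).1) ih'
      (Q.measy (k + 1) (by lia)).measurable
    simp_rw [Q.step_eq k]
    exact ((ih' t).const_mul _).add ((Phi_continuous.measurable.comp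
      ((((ih' t).PhiInv_comp fun ω => Q.mem_Ioo k ω t).sub
        ((hV.PhiInv_comp fun ω => Q.mem_Ioo k ω _).const_mul _)).div_const _)).const_mul _)

lemma integrable_Pk [IsProbabilityMeasure P] (k : ℕ) (t : ℝ) :
    Integrable (fun ω => Q.Pk k ω t) P := by
  refine Integrable.of_bound
    ((Q.measurable_Pk k t).mono (Q.ℱ.le k) le_rfl).aestronglyMeasurable 1 (ae_of_all _ fun ω => ?_)
  rw [Real.norm_of_nonneg (Q.mem_Ioo k ω t).1.le]
  exact (Q.mem_Ioo k ω t).2.le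

/-- The normal score of the next observation. -/
noncomputable def score (k : ℕ) (ω : Ω) : ℝ := PhiInv (Q.Pk k ω (Q.y (k + 1) ω))

lemma measurable_score (k : ℕ) : Measurable (Q.score k) :=
  (Measurable.eval_of_continuous (fun ω => (Q.continuous_and_mem_Ioo k ω).1)
    (fun t => (Q.measurable_Pk k t).mono (Q.ℱ.le k) le_rfl)
    ((Q.measy (k + 1) (by lia)).measurable.mono (Q.ℱ.le _) le_rfl)).PhiInv_comp
      fun ω => Q.mem_Ioo k ω _

lemma map_score_restrict [IsProbabilityMeasure P] (k : ℕ) {A : Set Ω}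
    (hA : MeasurableSet[Q.ℱ k] A) :
    (P.restrict A).map (Q.score k) = P A • gaussianReal 0 1 := by
  refine Measure.ext_of_Iic _ _ fun x => ?_
  rw [Measure.map_apply (Q.measurable_score k) measurableSet_Iic,
    Measure.restrict_apply (Q.measurable_score k measurableSet_Iic), Set.inter_comm,
    Measure.smul_apply, smul_eq_mul]
  have h := Q.unif (k + 1) (by lia) A hA (Phi x) (Set.Ioo_subset_Icc_self (Phi_mem_Ioo x))
  rw [Phi, ENNReal.ofReal_toReal (measure_ne_top _ _)] at h
  rw [← h]
  congr 2
  ext ω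
  exact PhiInv_le_iff (Q.mem_Ioo k ω _) x

lemma setIntegral_succ [IsProbabilityMeasure P] (k : ℕ) (t : ℝ) {A : Set Ω}
    (hA : MeasurableSet[Q.ℱ k] A) :
    ∫ ω in A, Q.Pk (k + 1) ω t ∂P = ∫ ω in A, Q.Pk k ω t ∂P := by
  let g : ℝ × ℝ → ℝ := fun p => Phi ((p.1 - Q.ρ * p.2) / Real.sqrt (1 - Q.ρ ^ 2))
  have hg : Measurable g := Phi_continuous.measurable.comp (by fun_prop)
  have hgC : ∀ p, ‖g p‖ ≤ 1 := fun p => by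
    rw [Real.norm_of_nonneg (Phi_mem_Ioo _).1.le]
    exact (Phi_mem_Ioo _).2.le
  have hX : Measurable[Q.ℱ k] fun ω => PhiInv (Q.Pk k ω t) :=
    (Q.measurable_Pk k t).PhiInv_comp fun ω => Q.mem_Ioo k ω t
  have hgint : Integrable (fun ω => g (PhiInv (Q.Pk k ω t), Q.score k ω)) P :=
    Integrable.of_bound (hg.comp ((hX.mono (Q.ℱ.le k) le_rfl).prodMk
      (Q.measurable_score k))).aestronglyMeasurable 1 (ae_of_all _ fun _ => hgC _)
  have hkey : ∫ ω in A, g (PhiInv (Q.Pk k ω t), Q.score k ω) ∂P = ∫ ω in A, Q.Pk k ω t ∂P := by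
    rw [setIntegral_comp_prod_of_map_restrict_eq (Q.ℱ.le k) hX (Q.measurable_score k)
      (fun B hB => Q.map_score_restrict k hB) hg hgC hA]
    refine integral_congr_ae (ae_of_all _ fun ω => ?_)
    exact (integral_Phi_div_sqrt Q.hρ _).trans (Phi_PhiInv (Q.mem_Ioo k ω t))
  have hstep : ∀ ω, Q.Pk (k + 1) ω t = (1 - Q.α (Q.n + (k + 1))) * Q.Pk k ω t
      + Q.α (Q.n + (k + 1)) * g (PhiInv (Q.Pk k ω t), Q.score k ω) := fun ω => Q.step_eq k ω t
  simp_rw [hstep]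
  rw [integral_add ((Q.integrable_Pk k t).integrableOn.const_mul _)
    (hgint.integrableOn.const_mul _), integral_const_mul, integral_const_mul, hkey]
  ring

end CopulaProcess

/-- In the copula-update process, for every fixed `y ∈ ℝ` the sequence `(P_M(y))_{M ≥ 0}`
is a martingale with respect to `(𝓕_M)_{M ≥ 0}`: each `P_M(y)` is `𝓕_M`-measurable,
integrable, and `E[P_M(y) | 𝓕_{M−1}] = P_{M−1}(y)` almost surely for every `M ≥ 1`. -/
theorem copulaProcess_martingale {Ω : Type*} [mΩ : MeasurableSpace Ω]
    (P : Measure Ω) [IsProbabilityMeasure P] (Q : CopulaProcess Ω P) (t : ℝ) :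
    (∀ M : ℕ, StronglyMeasurable[Q.ℱ M] fun ω => Q.Pk M ω t) ∧
    (∀ M : ℕ, Integrable (fun ω => Q.Pk M ω t) P) ∧
    (∀ M : ℕ, 1 ≤ M →
      P[(fun ω => Q.Pk M ω t) | Q.ℱ (M - 1)] =ᵐ[P] fun ω => Q.Pk (M - 1) ω t) := by
  refine ⟨fun M => (Q.measurable_Pk M t).stronglyMeasurable, fun M => Q.integrable_Pk M t,
    fun M hM => ?_⟩
  obtain ⟨k, rfl⟩ := Nat.exists_eq_add_of_le' hM
  refine (ae_eq_condExp_of_forall_setIntegral_eq (Q.ℱ.le k) (Q.integrable_Pk (k + 1) t)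
    (fun _ _ _ => (Q.integrable_Pk k t).integrableOn)
    (fun A hA _ => (Q.setIntegral_succ k t hA).symm)
    (Q.measurable_Pk k t).stronglyMeasurable.aestronglyMeasurable).symm
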